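/- ∫₀¹ a(s)/√(â(s)) ds = ∫₀¹ √(â(s)) ds, where the integrand on the left is interpreted as 0 at points where â(s) = 0. -/

import Mathlib

open MeasureTheory Set Filter

/-- Riemann integrability of `a` on `[0,1]`, encoded via the Lebesgue criterion:
`a` is bounded on `[0,1]`, almost everywhere continuous on `[0,1]`, and (Lebesgue)
integrable on `[0,1]`. -/
def RiemannIntegrableOn01 (a : ℝ → ℝ) : Prop :=
  IntegrableOn a (Set.Icc 0 1) volume ∧
  (∀ᵐ s ∂(volume.restrict (Set.Icc (0:ℝ) 1)), ContinuousAt a s) ∧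
  ∃ C : ℝ, ∀ s ∈ Set.Icc (0:ℝ) 1, |a s| ≤ C

open scoped Topology

/-- The left derivative of a concave function lies on the expected side of the slope of a
line supporting its graph. -/
lemma ConcaveOn.leftDeriv_le_of_supporting_line {S : Set ℝ} {f : ℝ → ℝ} {f' c t s : ℝ}
    (hf : ConcaveOn ℝ S f) (ht : t ∈ S) (hs : s ∈ S) (hts : t < s)
    (hline : f s ≤ f t + c * (s - t)) (hf' : HasDerivWithinAt f f' (Iic s) s) : f' ≤ c := by
  have h := hf.le_slope_of_hasDerivWithinAt_Iio ht hs hts (hf'.mono Iio_subset_Iic_self)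
  refine h.trans ?_
  rw [slope_def_field, div_le_iff₀ (sub_pos.2 hts)]
  linarith

lemma le_leftDeriv_of_supporting_line {f : ℝ → ℝ} {f' c t b : ℝ} (hb : b < t)
    (hline : ∀ x ∈ Ioo b t, f x ≤ f t + c * (x - t))
    (hf' : HasDerivWithinAt f f' (Iic t) t) : c ≤ f' := by
  have h := (hasDerivWithinAt_iff_tendsto_slope' self_notMem_Iio).1
    (hf'.mono Iio_subset_Iic_self)
  refine ge_of_tendsto h ?_
  filter_upwards [Ioo_mem_nhdsLT hb] with x hx
  rw [slope_comm, slope_def_field, le_div_iff₀ (sub_pos.2 hx.2)]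
  linarith [hline x hx]

/-- The fundamental theorem of calculus for left derivatives. -/
lemma integral_eq_sub_of_hasDeriv_left_of_le {f f' : ℝ → ℝ} {a b : ℝ} (hab : a ≤ b)
    (hcont : ContinuousOn f (Icc a b))
    (hderiv : ∀ x ∈ Ioo a b, HasDerivWithinAt f (f' x) (Iio x) x)
    (hint : IntervalIntegrable f' volume a b) : ∫ y in a..b, f' y = f b - f a := by
  have h := intervalIntegral.integral_eq_sub_of_hasDeriv_right_of_le
    (f := fun x ↦ f (-x)) (f' := fun x ↦ -f' (-x)) (neg_le_neg hab)
    (hcont.comp continuous_neg.continuousOn fun x hx ↦ ⟨by linarith [hx.2], by linarith [hx.1]⟩)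
    (fun x hx ↦ by
      have h₁ := hderiv (-x) ⟨by linarith [hx.2], by linarith [hx.1]⟩
      have hmaps : MapsTo (fun y ↦ -y) (Ioi x) (Iio (-x)) := fun y hy ↦ by simpa using hy
      have h₂ := h₁.scomp x (hasDerivAt_neg x).hasDerivWithinAt hmaps
      simpa only [Function.comp_def, neg_smul, one_smul] using h₂)
    (by simpa [Pi.neg_def] using (IntervalIntegrable.comp_sub_left hint 0).symm.neg)
  rw [intervalIntegral.integral_neg, intervalIntegral.integral_comp_neg] at h
  simp only [neg_neg] at h
  linarith

lemma withDensity_ofReal_apply_Ioc {f : ℝ → ℝ} {a b t : ℝ} (hf : IntegrableOn f (Ioc a b))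
    (hf0 : ∀ s ∈ Ioc a b, 0 ≤ f s) (ht : t ∈ Icc a b) :
    (volume.restrict (Ioc a b)).withDensity (fun s ↦ ENNReal.ofReal (f s)) (Ioc a t) =
      ENNReal.ofReal (∫ s in a..t, f s) := by
  have hsub : Ioc a t ⊆ Ioc a b := Ioc_subset_Ioc_right ht.2
  rw [withDensity_apply _ measurableSet_Ioc, Measure.restrict_restrict_of_subset hsub,
    intervalIntegral.integral_of_le ht.1, ofReal_integral_eq_lintegral_ofReal (hf.mono_set hsub)]
  filter_upwards [ae_restrict_mem measurableSet_Ioc] with s hs using hf0 s (hsub hs)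

lemma integral_withDensity_ofReal {f : ℝ → ℝ} {s : Set ℝ} (hs : MeasurableSet s)
    (hf : IntegrableOn f s) (hf0 : ∀ x ∈ s, 0 ≤ f x) (g : ℝ → ℝ) :
    ∫ x, g x ∂(volume.restrict s).withDensity (fun x ↦ ENNReal.ofReal (f x)) =
      ∫ x in s, f x * g x := by
  rw [integral_withDensity_eq_integral_toReal_smul₀ hf.aemeasurable.ennreal_ofReal (by simp)]
  refine setIntegral_congr_fun hs fun x hx ↦ ?_
  simp [ENNReal.toReal_ofReal (hf0 x hx)]

/-- Two finite measures on `(a, b]` giving the same mass to enough initial intervals cut out by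
the levels of `h` have the same image under `h`. -/
lemma map_eq_map_of_forall_exists_Ioc {μ ν : Measure ℝ} [IsFiniteMeasure μ] [IsFiniteMeasure ν]
    {h : ℝ → ℝ} {a b : ℝ} (hμ : AEMeasurable h μ) (hν : AEMeasurable h ν)
    (hμab : ∀ᵐ s ∂μ, s ∈ Ioc a b) (hνab : ∀ᵐ s ∂ν, s ∈ Ioc a b)
    (H : ∀ c : ℝ, ∃ t ∈ Icc a b, μ (Ioc a t) = ν (Ioc a t) ∧
      ∀ s ∈ Ioc a b, (s ≤ t → c ≤ h s) ∧ (t < s → h s ≤ c)) :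
    μ.map h = ν.map h := by
  refine Measure.ext_of_Ici _ _ fun c ↦ ?_
  rw [Measure.map_apply_of_aemeasurable hμ measurableSet_Ici,
    Measure.map_apply_of_aemeasurable hν measurableSet_Ici]
  obtain ⟨u, hu, huc, hlim⟩ := exists_seq_strictMono_tendsto c
  choose t ht hμν hth using fun n ↦ H (u n)
  have hanti : Antitone fun n ↦ Ioc a (t n) := by
    refine antitone_nat_of_succ_le fun n s hs ↦ ⟨hs.1, ?_⟩
    have hsab : s ∈ Ioc a b := ⟨hs.1, hs.2.trans (ht _).2⟩
    by_contra! hlt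
    have h₁ := ((hth _ s hsab).1 hs.2).trans ((hth n s hsab).2 hlt)
    exact absurd (hu n.lt_succ_self) h₁.not_gt
  have hinter : ∀ s ∈ Ioc a b, s ∈ ⋂ n, Ioc a (t n) ↔ s ∈ h ⁻¹' Ici c := by
    intro s hs
    simp only [mem_iInter, mem_preimage, mem_Ici]
    refine ⟨fun hst ↦ le_of_tendsto' hlim fun n ↦ (hth n s hs).1 (hst n).2,
      fun hcs n ↦ ⟨hs.1, ?_⟩⟩
    by_contra! hlt
    exact absurd ((hth n s hs).2 hlt) ((huc n).trans_le hcs).not_ge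
  have hμ' : μ (h ⁻¹' Ici c) = μ (⋂ n, Ioc a (t n)) :=
    measure_congr <| hμab.mono fun s hs ↦ propext (hinter s hs).symm
  have hν' : ν (h ⁻¹' Ici c) = ν (⋂ n, Ioc a (t n)) :=
    measure_congr <| hνab.mono fun s hs ↦ propext (hinter s hs).symm
  have hmeas (n) : MeasurableSet (Ioc a (t n)) := measurableSet_Ioc
  have h₁ := tendsto_measure_iInter_atTop (μ := μ) (fun n ↦ (hmeas n).nullMeasurableSet) hanti
    ⟨0, measure_ne_top _ _⟩
  have h₂ := tendsto_measure_iInter_atTop (μ := ν) (fun n ↦ (hmeas n).nullMeasurableSet) hanti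
    ⟨0, measure_ne_top _ _⟩
  rw [hμ', hν']
  exact tendsto_nhds_unique (h₁.congr hμν) h₂

theorem stmt14 (a A Ahat ahat : ℝ → ℝ)
    (ha_nonneg : ∀ s ∈ Set.Icc (0:ℝ) 1, 0 ≤ a s)
    (ha_int : RiemannIntegrableOn01 a)
    (hA : ∀ t ∈ Set.Icc (0:ℝ) 1, A t = ∫ s in (0:ℝ)..t, a s)
    (hA1 : A 1 = 1)
    (hAhat_conc : ConcaveOn ℝ (Set.Icc 0 1) Ahat)
    (hAhat_ge : ∀ t ∈ Set.Icc (0:ℝ) 1, A t ≤ Ahat t)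
    (hAhat_least : ∀ g : ℝ → ℝ, ConcaveOn ℝ (Set.Icc 0 1) g →
      (∀ t ∈ Set.Icc (0:ℝ) 1, A t ≤ g t) → ∀ t ∈ Set.Icc (0:ℝ) 1, Ahat t ≤ g t)
    (hahat_deriv : ∀ t ∈ Set.Ioc (0:ℝ) 1, HasDerivWithinAt Ahat (ahat t) (Set.Iic t) t)
    (hahat_nonneg : ∀ t ∈ Set.Ioc (0:ℝ) 1, 0 ≤ ahat t)
    (hahat_anti : AntitoneOn ahat (Set.Ioc 0 1)) :
    (∫ s in Set.Ioc (0:ℝ) 1, (if ahat s = 0 then 0 else a s / Real.sqrt (ahat s))) =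
      ∫ s in Set.Ioc (0:ℝ) 1, Real.sqrt (ahat s) := by
  obtain ⟨haI, -, C, hC⟩ := ha_int
  have haI' : IntegrableOn a (Ioc 0 1) := haI.mono_set Ioc_subset_Icc_self
  have ha0 : ∀ s ∈ Ioc (0:ℝ) 1, 0 ≤ a s := fun s hs ↦ ha_nonneg s (Ioc_subset_Icc_self hs)
  have hA0 : ∀ t ∈ Icc (0:ℝ) 1, 0 ≤ A t := fun t ht ↦ by
    rw [hA t ht]
    exact intervalIntegral.integral_nonneg ht.1 fun s hs ↦ ha_nonneg s ⟨hs.1, hs.2.trans ht.2⟩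
  have hAC : ∀ t ∈ Icc (0:ℝ) 1, A t ≤ C * t := fun t ht ↦ by
    have h := intervalIntegral.norm_integral_le_of_norm_le_const (a := 0) (b := t) (f := a) (C := C)
      fun s hs ↦ by
        rw [uIoc_of_le ht.1] at hs
        exact hC s ⟨hs.1.le, hs.2.trans ht.2⟩
    rw [sub_zero, abs_of_nonneg ht.1, ← hA t ht] at h
    exact (le_abs_self _).trans h
  have hconc (c m : ℝ) : ConcaveOn ℝ (Icc (0:ℝ) 1) fun t ↦ c * t + m :=
    ⟨convex_Icc 0 1, fun x _ y _ p q _ _ hpq ↦ by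
      simp only [smul_eq_mul]
      exact le_of_eq (by linear_combination m * hpq)⟩
  have hline (c m : ℝ) (h : ∀ t ∈ Icc (0:ℝ) 1, A t ≤ c * t + m) :
      ∀ t ∈ Icc (0:ℝ) 1, Ahat t ≤ c * t + m := hAhat_least _ (hconc c m) h
  have hAhatC : ∀ t ∈ Icc (0:ℝ) 1, Ahat t ≤ C * t := by
    simpa using hline C 0 (by simpa using hAC)
  have h01 : (0:ℝ) ∈ Icc (0:ℝ) 1 := by simp
  have hAhat0 : Ahat 0 = 0 :=
    le_antisymm (by simpa using hAhatC 0 h01) ((hA0 0 h01).trans (hAhat_ge 0 h01))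
  have hahatC : ∀ t ∈ Ioc (0:ℝ) 1, ahat t ≤ C := fun t ht ↦
    hAhat_conc.leftDeriv_le_of_supporting_line h01 (Ioc_subset_Icc_self ht) ht.1
      (by simpa [hAhat0] using hAhatC t (Ioc_subset_Icc_self ht)) (hahat_deriv t ht)
  have hmeas : AEMeasurable ahat (volume.restrict (Ioc 0 1)) :=
    aemeasurable_restrict_of_antitoneOn measurableSet_Ioc hahat_anti
  have hahatI : IntegrableOn ahat (Ioc 0 1) := by
    refine Integrable.of_bound hmeas.aestronglyMeasurable C ?_
    filter_upwards [ae_restrict_mem measurableSet_Ioc] with s hs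
    rw [Real.norm_of_nonneg (hahat_nonneg s hs)]
    exact hahatC s hs
  have hcont : ContinuousOn Ahat (Icc 0 1) := by
    intro t ht
    rcases ht.1.eq_or_lt with rfl | h0
    · have h1 : Tendsto (fun t : ℝ ↦ C * t) (𝓝[Icc 0 1] 0) (𝓝 0) := by
        have : Continuous fun t : ℝ ↦ C * t := by fun_prop
        simpa using (this.tendsto 0).mono_left nhdsWithin_le_nhds
      rw [ContinuousWithinAt, hAhat0]
      refine tendsto_of_tendsto_of_tendsto_of_le_of_le' tendsto_const_nhds h1 ?_ ?_
      · filter_upwards [self_mem_nhdsWithin] with s hs using (hA0 s hs).trans (hAhat_ge s hs)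
      · filter_upwards [self_mem_nhdsWithin] with s hs using hAhatC s hs
    rcases ht.2.eq_or_lt with rfl | h1
    · exact (hahat_deriv 1 ⟨h0, le_rfl⟩).continuousWithinAt.mono Icc_subset_Iic_self
    · refine ContinuousAt.continuousWithinAt ?_
      refine hAhat_conc.continuousOn_interior.continuousAt ?_
      rw [interior_Icc]
      exact Ioo_mem_nhds h0 h1
  have hFTC : ∀ t ∈ Icc (0:ℝ) 1, ∫ s in (0:ℝ)..t, ahat s = Ahat t := fun t ht ↦ by
    rw [integral_eq_sub_of_hasDeriv_left_of_le ht.1 (hcont.mono (Icc_subset_Icc_right ht.2))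
      (fun x hx ↦ (hahat_deriv x ⟨hx.1, hx.2.le.trans ht.2⟩).mono Iio_subset_Iic_self)
      ((intervalIntegrable_iff_integrableOn_Ioc_of_le ht.1).2
        (hahatI.mono_set (Ioc_subset_Ioc_right ht.2))), hAhat0, sub_zero]
  have hAcont : ContinuousOn A (Icc 0 1) := by
    have h := intervalIntegral.continuousOn_primitive_interval (μ := volume) (f := a)
      (a := 0) (b := 1) (by rwa [uIcc_of_le zero_le_one])
    rw [uIcc_of_le zero_le_one] at h
    exact h.congr hA
  have hcontact (c : ℝ) : ∃ t ∈ Icc (0:ℝ) 1, A t = Ahat t ∧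
      ∀ s ∈ Icc (0:ℝ) 1, Ahat s ≤ Ahat t + c * (s - t) := by
    obtain ⟨t, ht, hmax⟩ := isCompact_Icc.exists_isMaxOn ⟨0, h01⟩
      (hAcont.sub (by fun_prop : ContinuousOn (fun s : ℝ ↦ c * s) (Icc 0 1)))
    have hle := hline c (A t - c * t) fun s hs ↦ by
      have := hmax hs
      simp only [mem_ofPred_eq, Pi.sub_apply] at this
      linarith
    have heq : A t = Ahat t := le_antisymm (hAhat_ge t ht) (by linarith [hle t ht])
    exact ⟨t, ht, heq, fun s hs ↦ by linarith [hle s hs]⟩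
  let μ := (volume.restrict (Ioc (0:ℝ) 1)).withDensity fun s ↦ ENNReal.ofReal (a s)
  let ν := (volume.restrict (Ioc (0:ℝ) 1)).withDensity fun s ↦ ENNReal.ofReal (ahat s)
  have hμac : μ ≪ volume.restrict (Ioc 0 1) := withDensity_absolutelyContinuous _ _
  have hνac : ν ≪ volume.restrict (Ioc 0 1) := withDensity_absolutelyContinuous _ _
  have : IsFiniteMeasure μ := isFiniteMeasure_withDensity_ofReal haI'.2
  have : IsFiniteMeasure ν := isFiniteMeasure_withDensity_ofReal hahatI.2
  have hμm := hmeas.mono_ac hμac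
  have hνm := hmeas.mono_ac hνac
  have hmap : μ.map ahat = ν.map ahat := by
    refine map_eq_map_of_forall_exists_Ioc hμm hνm
      (hμac.ae_le (ae_restrict_mem measurableSet_Ioc))
      (hνac.ae_le (ae_restrict_mem measurableSet_Ioc)) fun c ↦ ?_
    obtain ⟨t, ht, heq, hsupp⟩ := hcontact c
    refine ⟨t, ht, ?_, fun s hs ↦ ⟨fun hst ↦ ?_, fun hts ↦ ?_⟩⟩
    · rw [withDensity_ofReal_apply_Ioc haI' ha0 ht,
        withDensity_ofReal_apply_Ioc hahatI hahat_nonneg ht, hFTC t ht, ← hA t ht, heq]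
    · have ht' : t ∈ Ioc (0:ℝ) 1 := ⟨hs.1.trans_le hst, ht.2⟩
      exact (le_leftDeriv_of_supporting_line ht'.1
        (fun x hx ↦ hsupp x ⟨hx.1.le, hx.2.le.trans ht.2⟩) (hahat_deriv t ht')).trans
        (hahat_anti hs ht' hst)
    · exact hAhat_conc.leftDeriv_le_of_supporting_line ht (Ioc_subset_Icc_self hs) hts
        (hsupp s (Ioc_subset_Icc_self hs)) (hahat_deriv s hs)
  let φ : ℝ → ℝ := fun x ↦ if x = 0 then 0 else (Real.sqrt x)⁻¹
  have hφ : Measurable φ :=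
    Measurable.ite (measurableSet_singleton 0) measurable_const Real.continuous_sqrt.measurable.inv
  calc ∫ s in Ioc (0:ℝ) 1, (if ahat s = 0 then 0 else a s / Real.sqrt (ahat s))
      = ∫ s in Ioc (0:ℝ) 1, a s * φ (ahat s) := by
        congr with s
        by_cases h : ahat s = 0 <;> simp [φ, h, div_eq_mul_inv]
    _ = ∫ s, φ (ahat s) ∂μ := (integral_withDensity_ofReal measurableSet_Ioc haI' ha0 _).symm
    _ = ∫ x, φ x ∂μ.map ahat := (integral_map hμm hφ.aestronglyMeasurable).symm
    _ = ∫ s, φ (ahat s) ∂ν := by rw [hmap, integral_map hνm hφ.aestronglyMeasurable]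
    _ = ∫ s in Ioc (0:ℝ) 1, ahat s * φ (ahat s) :=
        integral_withDensity_ofReal measurableSet_Ioc hahatI hahat_nonneg _
    _ = ∫ s in Ioc (0:ℝ) 1, Real.sqrt (ahat s) := by
        congr with s
        by_cases h : ahat s = 0
        · simp [φ, h]
        · simp [φ, h, ← div_eq_mul_inv, Real.div_sqrt]
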